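/- Least-squares generalization bound for adapted data: In the sequential regression setting below, let γ ≥ 0 and suppose that almost surely min_{h ∈ ℋ} Σ_{t=1}^T E[( h*(x_t) − h(x_t) )² | 𝒢_{t−1}] ≤ γ·T. Let ĥ : Ω → ℋ be any 𝒢_T-measurable empirical risk minimizer, i.e. almost surely Σ_{t=1}^T ( ĥ(ω)(x_t(ω)) − y_t(ω) )² = min_{h ∈ ℋ} Σ_{t=1}^T ( h(x_t(ω)) − y_t(ω) )². Then for every δ ∈ (0,1), with probability at least 1 − δ over ω: Σ_{t=1}^T E[( h(x_t) − h*(x_t) )² | 𝒢_{t−1}](ω), evaluated at h = ĥ(ω), is at most 3·γ·T + 256·R²·log(2·|ℋ|/δ). -/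

import Mathlib

open Finset MeasureTheory

lemma aux_condExp_bdd {Ω : Type*} {m0 : MeasurableSpace Ω} (μ : Measure Ω)
    [IsProbabilityMeasure μ] (m : MeasurableSpace Ω) (hm : m ≤ m0)
    (W : Ω → ℝ) (hW : Measurable[m0] W) (hb : ∀ᵐ ω ∂μ, |W ω| ≤ 1) :
    ∀ᵐ ω ∂μ, |(μ[fun ω' => W ω' + W ω' ^ 2 | m]) ω| ≤ 2 := by
  have h : ∀ᵐ ω ∂μ, |(fun ω' => W ω' + W ω' ^ 2) ω| ≤ ((2 : NNReal) : ℝ) := by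
    filter_upwards [hb] with ω h
    have := abs_le.1 h
    rw [abs_le]
    push_cast
    constructor <;> nlinarith
  have := ae_bdd_condExp_of_ae_bdd (m := m) h
  simpa using this

lemma aux_condExp_exp {Ω : Type*} {m0 : MeasurableSpace Ω} (μ : Measure Ω)
    [IsProbabilityMeasure μ] (m : MeasurableSpace Ω) (hm : m ≤ m0)
    (W : Ω → ℝ) (hW : Measurable[m0] W) (hb : ∀ᵐ ω ∂μ, |W ω| ≤ 1) :
    ∀ᵐ ω ∂μ, (μ[fun ω' => Real.exp (W ω') | m]) ω
      ≤ Real.exp ((μ[fun ω' => W ω' + W ω' ^ 2 | m]) ω) := by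
  have i1 : Integrable (fun ω' => Real.exp (W ω')) μ := by
    refine Integrable.of_bound (by fun_prop) (Real.exp 1) ?_
    filter_upwards [hb] with ω h
    rw [Real.norm_eq_abs, Real.abs_exp]
    exact Real.exp_le_exp.2 (abs_le.1 h).2
  have i2 : Integrable (fun ω' => W ω' + W ω' ^ 2) μ := by
    refine Integrable.of_bound (by fun_prop) 2 ?_
    filter_upwards [hb] with ω h
    have := abs_le.1 h
    rw [Real.norm_eq_abs, abs_le]
    constructor <;> nlinarith
  have h1 : (fun ω' => Real.exp (W ω')) ≤ᵐ[μ]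
      ((fun _ => (1 : ℝ)) + fun ω' => W ω' + W ω' ^ 2) := by
    filter_upwards [hb] with ω h
    have := (abs_le.1 (Real.abs_exp_sub_one_sub_id_le h)).2
    simp only [Pi.add_apply]
    linarith
  have h2 := condExp_mono (m := m) i1 ((integrable_const (1 : ℝ)).add i2) h1
  have h3 := condExp_add (integrable_const (1 : ℝ)) i2 m (μ := μ)
  filter_upwards [h2, h3] with ω a b
  rw [b, Pi.add_apply, condExp_const hm] at a
  refine a.trans ?_
  rw [add_comm]
  exact Real.add_one_le_exp _

lemma aux_exp_bound {Ω : Type*} {m0 : MeasurableSpace Ω} (μ : Measure Ω)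
    [IsProbabilityMeasure μ] (T : ℕ) (𝒢 : ℕ → MeasurableSpace Ω)
    (h𝒢mono : ∀ i j, i ≤ j → 𝒢 i ≤ 𝒢 j) (h𝒢le : ∀ i, 𝒢 i ≤ m0)
    (W : ℕ → Ω → ℝ) (hW : ∀ t ∈ Finset.Icc 1 T, Measurable[𝒢 t] (W t))
    (hb : ∀ t ∈ Finset.Icc 1 T, ∀ᵐ ω ∂μ, |W t ω| ≤ 1) :
    ∀ n ≤ T,
      Integrable (fun ω => Real.exp (∑ t ∈ Finset.Icc 1 n,
        (W t ω - (μ[fun ω' => W t ω' + W t ω' ^ 2 | 𝒢 (t - 1)]) ω))) μ ∧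
      ∫ ω, Real.exp (∑ t ∈ Finset.Icc 1 n,
        (W t ω - (μ[fun ω' => W t ω' + W t ω' ^ 2 | 𝒢 (t - 1)]) ω)) ∂μ ≤ 1 := by
  set P : ℕ → Ω → ℝ := fun t => μ[fun ω' => W t ω' + W t ω' ^ 2 | 𝒢 (t - 1)] with hP
  have hPm : ∀ t, Measurable[𝒢 (t - 1)] (P t) := fun t =>
    stronglyMeasurable_condExp.measurable
  have hSm : ∀ n ≤ T, Measurable[𝒢 n] (fun ω => ∑ t ∈ Finset.Icc 1 n, (W t ω - P t ω)) := by
    intro n hn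
    refine Finset.measurable_fun_sum _ fun t ht => ?_
    have ht' := Finset.mem_Icc.1 ht
    exact ((hW t (Finset.mem_Icc.2 ⟨ht'.1, ht'.2.trans hn⟩)).mono
      (h𝒢mono _ _ ht'.2) le_rfl).sub ((hPm t).mono (h𝒢mono _ _ (by omega)) le_rfl)
  have hPb : ∀ t ∈ Finset.Icc 1 T, ∀ᵐ ω ∂μ, |P t ω| ≤ 2 := fun t ht =>
    aux_condExp_bdd μ _ (h𝒢le _) _ ((hW t ht).mono (h𝒢le _) le_rfl) (hb t ht)
  have hSb : ∀ n ≤ T, ∀ᵐ ω ∂μ, ∑ t ∈ Finset.Icc 1 n, (W t ω - P t ω) ≤ n * 3 := by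
    intro n hn
    have h1 : ∀ᵐ ω ∂μ, ∀ t ∈ Finset.Icc 1 T, |W t ω| ≤ 1 := by
      rw [← Finset.eventually_all] at *; exact hb
    have h2 : ∀ᵐ ω ∂μ, ∀ t ∈ Finset.Icc 1 T, |P t ω| ≤ 2 := by
      rw [← Finset.eventually_all] at *; exact hPb
    filter_upwards [h1, h2] with ω a b
    have := Finset.sum_le_card_nsmul (Finset.Icc 1 n) (fun t => W t ω - P t ω) 3 ?_
    · simpa using this
    · intro t ht
      have ht' := Finset.mem_Icc.1 ht
      have m := Finset.mem_Icc.2 ⟨ht'.1, ht'.2.trans hn⟩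
      have := abs_le.1 (a t m)
      have := abs_le.1 (b t m)
      linarith
  have hI : ∀ n ≤ T, Integrable (fun ω => Real.exp (∑ t ∈ Finset.Icc 1 n, (W t ω - P t ω))) μ := by
    intro n hn
    refine Integrable.of_bound
      (((hSm n hn).mono (h𝒢le n) le_rfl).exp).aestronglyMeasurable (Real.exp (n * 3)) ?_
    filter_upwards [hSb n hn] with ω h
    rw [Real.norm_eq_abs, Real.abs_exp]
    exact Real.exp_le_exp.2 h
  intro n hn
  refine ⟨hI n hn, ?_⟩
  induction n with
  | zero => simp
  | succ n ih =>
    have ih := ih (by omega)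
    have hmem : n + 1 ∈ Finset.Icc 1 T := Finset.mem_Icc.2 ⟨by omega, hn⟩
    set A : Ω → ℝ := fun ω =>
      Real.exp (∑ t ∈ Finset.Icc 1 n, (W t ω - P t ω) - P (n + 1) ω) with hA
    set B : Ω → ℝ := fun ω => Real.exp (W (n + 1) ω) with hB
    have hAB : (fun ω => Real.exp (∑ t ∈ Finset.Icc 1 (n + 1), (W t ω - P t ω))) = A * B := by
      funext ω
      rw [Pi.mul_apply, hA, hB]
      simp only
      rw [← Real.exp_add, Finset.sum_Icc_succ_top (by omega)]
      congr 1; ring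
    have hWm : Measurable (W (n + 1)) := (hW _ hmem).mono (h𝒢le _) le_rfl
    have hAm : StronglyMeasurable[𝒢 n] A := by
      refine Measurable.stronglyMeasurable (Measurable.exp ?_)
      exact (hSm n (by omega)).sub (hPm (n + 1))
    have hIB : Integrable B μ := by
      refine Integrable.of_bound (hWm.exp).aestronglyMeasurable (Real.exp 1) ?_
      filter_upwards [hb _ hmem] with ω h
      rw [Real.norm_eq_abs, Real.abs_exp]
      exact Real.exp_le_exp.2 (abs_le.1 h).2
    have hIAB : Integrable (A * B) μ := hAB ▸ hI (n + 1) hn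
    have hpull := condExp_mul_of_stronglyMeasurable_left hAm hIAB hIB
    rw [hAB, ← integral_condExp (h𝒢le n)]
    refine le_trans (integral_mono_ae integrable_condExp (hI n (by omega)) ?_) ih
    filter_upwards [hpull, aux_condExp_exp μ (𝒢 n) (h𝒢le n) _ hWm (hb _ hmem)] with ω a b
    rw [a, Pi.mul_apply]
    have e : Real.exp (∑ t ∈ Finset.Icc 1 n, (W t ω - P t ω)) =
        A ω * Real.exp (P (n + 1) ω) := by
      rw [hA]; simp only; rw [← Real.exp_add]; congr 1; ring
    simp only [e]
    exact mul_le_mul_of_nonneg_left b (Real.exp_pos _).le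

lemma aux_condExp_Z {Ω : Type*} {m0 : MeasurableSpace Ω} (μ : Measure Ω)
    [IsProbabilityMeasure μ] (𝒢 ℋ : MeasurableSpace Ω) (h1 : 𝒢 ≤ ℋ) (h2 : ℋ ≤ m0)
    (R : ℝ) (f g y : Ω → ℝ) (hf : Measurable[ℋ] f) (hg : Measurable[ℋ] g) (hy : Measurable[m0] y)
    (bf : ∀ ω, |f ω| ≤ R) (bg : ∀ ω, |g ω| ≤ R) (yb : ∀ᵐ ω ∂μ, |y ω| ≤ R)
    (hc : μ[y | ℋ] =ᵐ[μ] g) :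
    μ[fun ω => (f ω - y ω) ^ 2 - (g ω - y ω) ^ 2 | 𝒢] =ᵐ[μ] μ[fun ω => (f ω - g ω) ^ 2 | 𝒢] := by
  have hf' : Measurable[m0] f := hf.mono h2 le_rfl
  have hg' : Measurable[m0] g := hg.mono h2 le_rfl
  have e : (fun ω => (f ω - y ω) ^ 2 - (g ω - y ω) ^ 2) =
      (fun ω => f ω ^ 2 - g ω ^ 2) + (fun ω => -2 * (f ω - g ω)) * y := by
    funext ω; simp only [Pi.add_apply, Pi.mul_apply]; ring
  have iy : Integrable y μ := Integrable.of_bound hy.aestronglyMeasurable R yb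
  have ia : Integrable (fun ω => f ω ^ 2 - g ω ^ 2) μ := by
    refine Integrable.of_bound (by fun_prop) (R ^ 2) (Filter.Eventually.of_forall fun ω => ?_)
    have := sq_le_sq' (abs_le.1 (bf ω)).1 (abs_le.1 (bf ω)).2
    have := sq_le_sq' (abs_le.1 (bg ω)).1 (abs_le.1 (bg ω)).2
    rw [Real.norm_eq_abs, abs_le]
    constructor <;> nlinarith
  have ib : Integrable ((fun ω => -2 * (f ω - g ω)) * y) μ := by
    refine iy.bdd_mul (c := 4 * R) (by fun_prop) (Filter.Eventually.of_forall fun ω => ?_)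
    have := abs_le.1 (bf ω)
    have := abs_le.1 (bg ω)
    rw [Real.norm_eq_abs, abs_le]
    constructor <;> linarith
  have sa : StronglyMeasurable[ℋ] (fun ω => f ω ^ 2 - g ω ^ 2) :=
    ((hf.pow_const 2).sub (hg.pow_const 2)).stronglyMeasurable
  have sb : StronglyMeasurable[ℋ] (fun ω => -2 * (f ω - g ω)) :=
    ((hf.sub hg).const_mul (-2)).stronglyMeasurable
  have key : μ[fun ω => (f ω - y ω) ^ 2 - (g ω - y ω) ^ 2 | ℋ] =ᵐ[μ]
      fun ω => (f ω - g ω) ^ 2 := by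
    rw [e]
    filter_upwards [condExp_add ia ib ℋ, condExp_mul_of_stronglyMeasurable_left sb ib iy, hc]
      with ω a b c
    rw [a, Pi.add_apply, b, Pi.mul_apply, c, condExp_of_stronglyMeasurable h2 sa ia]
    ring
  exact (condExp_condExp_of_le h1 h2).symm.trans (condExp_congr_ae key)

lemma aux_tail {Ω : Type*} {m0 : MeasurableSpace Ω} (μ : Measure Ω) [IsProbabilityMeasure μ]
    (T : ℕ) (𝒢 : ℕ → MeasurableSpace Ω)
    (h𝒢mono : ∀ i j, i ≤ j → 𝒢 i ≤ 𝒢 j) (h𝒢le : ∀ i, 𝒢 i ≤ m0)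
    {X : Type*} [MeasurableSpace X]
    (R : ℝ) (hR : 0 < R) (h : X → ℝ)
    (hHmeas : Measurable h) (hHbdd : ∀ z, |h z| ≤ R)
    (hstar : X → ℝ) (hstarMeas : Measurable hstar) (hstarBdd : ∀ z, |hstar z| ≤ R)
    (ℋ : ℕ → MeasurableSpace Ω)
    (hℋ : ∀ t ∈ Finset.Icc 1 T, 𝒢 (t - 1) ≤ ℋ t ∧ ℋ t ≤ 𝒢 t)
    (x : ℕ → Ω → X) (hx : ∀ t ∈ Finset.Icc 1 T, Measurable[ℋ t] (x t))
    (y : ℕ → Ω → ℝ) (hy : ∀ t ∈ Finset.Icc 1 T, Measurable[𝒢 t] (y t))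
    (hybdd : ∀ t ∈ Finset.Icc 1 T, ∀ᵐ ω ∂μ, |y t ω| ≤ R)
    (hcond : ∀ t ∈ Finset.Icc 1 T, μ[y t | ℋ t] =ᵐ[μ] fun ω => hstar (x t ω))
    (s : ℝ) (hs : |s| = 1) (L : ℝ) :
    μ {ω | 32 * R ^ 2 * L ≤ ∑ t ∈ Finset.Icc 1 T,
        (s * ((h (x t ω) - y t ω) ^ 2 - (hstar (x t ω) - y t ω) ^ 2) -
          (s + 1 / 2) * (μ[fun ω' => (h (x t ω') - hstar (x t ω')) ^ 2 | 𝒢 (t - 1)]) ω)}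
      ≤ ENNReal.ofReal (Real.exp (-L)) := by
  set c : ℝ := 1 / (32 * R ^ 2) with hcdef
  have hcpos : 0 < c := by positivity
  have hcR : c * (32 * R ^ 2) = 1 := by rw [hcdef]; field_simp
  have hs2 : s ^ 2 = 1 := by rw [← sq_abs, hs]; norm_num
  set Z : ℕ → Ω → ℝ := fun t ω => (h (x t ω) - y t ω) ^ 2 - (hstar (x t ω) - y t ω) ^ 2 with hZ
  set D : ℕ → Ω → ℝ := fun t ω => (h (x t ω) - hstar (x t ω)) ^ 2 with hD
  set W : ℕ → Ω → ℝ := fun t ω => s * c * Z t ω with hWdef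
  have hxG : ∀ t ∈ Finset.Icc 1 T, Measurable[𝒢 t] (x t) := fun t ht =>
    (hx t ht).mono (hℋ t ht).2 le_rfl
  have hZm : ∀ t ∈ Finset.Icc 1 T, Measurable[𝒢 t] (Z t) := fun t ht =>
    (((hHmeas.comp (hxG t ht)).sub (hy t ht)).pow_const 2).sub
      (((hstarMeas.comp (hxG t ht)).sub (hy t ht)).pow_const 2)
  have hDm : ∀ t ∈ Finset.Icc 1 T, Measurable (D t) := fun t ht =>
    ((((hHmeas.comp (hxG t ht)).sub (hstarMeas.comp (hxG t ht))).pow_const 2)).mono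
      (h𝒢le t) le_rfl
  have hWm : ∀ t ∈ Finset.Icc 1 T, Measurable[𝒢 t] (W t) := fun t ht =>
    (hZm t ht).const_mul _
  have hZ2 : ∀ t ∈ Finset.Icc 1 T, ∀ᵐ ω ∂μ, Z t ω ^ 2 ≤ 16 * R ^ 2 * D t ω := by
    intro t ht
    filter_upwards [hybdd t ht] with ω h1
    have h2 := abs_le.1 (hHbdd (x t ω))
    have h3 := abs_le.1 (hstarBdd (x t ω))
    have h1 := abs_le.1 h1
    have e : Z t ω ^ 2 = D t ω * (h (x t ω) + hstar (x t ω) - 2 * y t ω) ^ 2 := by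
      simp only [hZ, hD]; ring
    have : (h (x t ω) + hstar (x t ω) - 2 * y t ω) ^ 2 ≤ (4 * R) ^ 2 :=
      sq_le_sq' (by linarith) (by linarith)
    rw [e]
    have := mul_le_mul_of_nonneg_left this (sq_nonneg (h (x t ω) - hstar (x t ω)))
    simp only [hD]
    nlinarith
  have hDb : ∀ t ω, D t ω ≤ 4 * R ^ 2 := by
    intro t ω
    have h2 := abs_le.1 (hHbdd (x t ω))
    have h3 := abs_le.1 (hstarBdd (x t ω))
    have : (h (x t ω) - hstar (x t ω)) ^ 2 ≤ (2 * R) ^ 2 :=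
      sq_le_sq' (by linarith) (by linarith)
    simp only [hD]; linarith
  have hD0 : ∀ t ω, 0 ≤ D t ω := fun t ω => sq_nonneg _
  have hW2 : ∀ t ∈ Finset.Icc 1 T, ∀ᵐ ω ∂μ, W t ω ^ 2 ≤ c / 2 * D t ω := by
    intro t ht
    filter_upwards [hZ2 t ht] with ω a
    have : W t ω ^ 2 = c ^ 2 * Z t ω ^ 2 := by
      simp only [hWdef]; rw [mul_pow, mul_pow, hs2]; ring
    rw [this]
    calc c ^ 2 * Z t ω ^ 2 ≤ c ^ 2 * (16 * R ^ 2 * D t ω) := by gcongr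
      _ = c * (c * (32 * R ^ 2)) / 2 * D t ω := by ring
      _ = _ := by rw [hcR]; ring
  have hWb : ∀ t ∈ Finset.Icc 1 T, ∀ᵐ ω ∂μ, |W t ω| ≤ 1 := by
    intro t ht
    filter_upwards [hW2 t ht] with ω a
    rw [← sq_le_one_iff_abs_le_one]
    have := mul_le_mul_of_nonneg_left (hDb t ω) hcpos.le
    nlinarith
  have hDi : ∀ t ∈ Finset.Icc 1 T, Integrable (D t) μ := fun t ht =>
    Integrable.of_bound (hDm t ht).aestronglyMeasurable (4 * R ^ 2)
      (Filter.Eventually.of_forall fun ω => by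
        rw [Real.norm_eq_abs, abs_of_nonneg (hD0 t ω)]; exact hDb t ω)
  have hPle : ∀ t ∈ Finset.Icc 1 T, ∀ᵐ ω ∂μ,
      (μ[fun ω' => W t ω' + W t ω' ^ 2 | 𝒢 (t - 1)]) ω ≤
        c * ((s + 1 / 2) * (μ[D t | 𝒢 (t - 1)]) ω) := by
    intro t ht
    have hWm' : Measurable (W t) := (hWm t ht).mono (h𝒢le t) le_rfl
    have iW : Integrable (W t) μ := Integrable.of_bound hWm'.aestronglyMeasurable 1 (hWb t ht)
    have iW2 : Integrable (fun ω => W t ω ^ 2) μ := by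
      refine Integrable.of_bound (by fun_prop) 1 ?_
      filter_upwards [hWb t ht] with ω a
      rw [Real.norm_eq_abs, abs_of_nonneg (sq_nonneg _)]
      exact (sq_le_one_iff_abs_le_one _).2 a
    have k1 := condExp_add iW iW2 (𝒢 (t - 1))
    have k2 := condExp_mono (m := 𝒢 (t - 1)) iW2 ((hDi t ht).const_mul (c / 2)) (hW2 t ht)
    have k3 := condExp_smul (μ := μ) (c / 2) (D t) (𝒢 (t - 1))
    have k4 := condExp_smul (μ := μ) (s * c) (Z t) (𝒢 (t - 1))
    have k5 := aux_condExp_Z μ (𝒢 (t - 1)) (ℋ t) (hℋ t ht).1 ((hℋ t ht).2.trans (h𝒢le t)) R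
      (fun ω => h (x t ω)) (fun ω => hstar (x t ω)) (y t) (hHmeas.comp (hx t ht))
      (hstarMeas.comp (hx t ht)) ((hy t ht).mono (h𝒢le t) le_rfl)
      (fun _ => hHbdd _) (fun _ => hstarBdd _) (hybdd t ht) (hcond t ht)
    filter_upwards [k1, k2, k3, k4, k5] with ω a1 a2 a3 a4 a5
    change (μ[fun ω' => W t ω' + W t ω' ^ 2 | 𝒢 (t - 1)]) ω = _ at a1
    change _ ≤ (μ[(c / 2) • D t | 𝒢 (t - 1)]) ω at a2
    change (μ[W t | 𝒢 (t - 1)]) ω = _ at a4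
    change (μ[Z t | 𝒢 (t - 1)]) ω = (μ[D t | 𝒢 (t - 1)]) ω at a5
    rw [a3] at a2
    rw [a1, Pi.add_apply, a4]
    simp only [Pi.smul_apply, smul_eq_mul] at *
    rw [a5]
    linarith
  obtain ⟨hint, hle⟩ := aux_exp_bound μ T 𝒢 h𝒢mono h𝒢le W hWm hWb T le_rfl
  have markov := mul_meas_ge_le_integral_of_nonneg
    (Filter.Eventually.of_forall fun ω => (Real.exp_pos _).le) hint (Real.exp L)
  have hall : ∀ᵐ ω ∂μ, ∀ t ∈ Finset.Icc 1 T,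
      (μ[fun ω' => W t ω' + W t ω' ^ 2 | 𝒢 (t - 1)]) ω ≤
        c * ((s + 1 / 2) * (μ[D t | 𝒢 (t - 1)]) ω) := by
    rw [← Finset.eventually_all] at *; exact hPle
  set E : Set Ω := {ω | Real.exp L ≤ Real.exp (∑ t ∈ Finset.Icc 1 T,
        (W t ω - (μ[fun ω' => W t ω' + W t ω' ^ 2 | 𝒢 (t - 1)]) ω))} with hE
  have hEle : μ E ≤ ENNReal.ofReal (Real.exp (-L)) := by
    rw [← ofReal_measureReal]
    refine ENNReal.ofReal_le_ofReal ?_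
    rw [Real.exp_neg, ← one_div, le_div_iff₀ (Real.exp_pos _), mul_comm]
    exact markov.trans hle
  refine le_trans (measure_mono_ae ?_) hEle
  filter_upwards [hall] with ω a hω
  change 32 * R ^ 2 * L ≤ ∑ t ∈ Finset.Icc 1 T,
    (s * Z t ω - (s + 1 / 2) * (μ[D t | 𝒢 (t - 1)]) ω) at hω
  change Real.exp L ≤ Real.exp _
  refine Real.exp_le_exp.2 ?_
  have := mul_le_mul_of_nonneg_left hω hcpos.le
  rw [← mul_assoc, hcR, one_mul, Finset.mul_sum] at this
  refine this.trans (Finset.sum_le_sum fun t ht => ?_)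
  have := a t ht
  simp only [hWdef] at *
  linarith



/-- **Least-squares generalization bound for adapted data.** -/
theorem least_squares_generalization
    {Ω : Type*} {m0 : MeasurableSpace Ω} (μ : Measure Ω) [IsProbabilityMeasure μ]
    (T : ℕ)
    (𝒢 : ℕ → MeasurableSpace Ω)
    (h𝒢mono : ∀ i j, i ≤ j → 𝒢 i ≤ 𝒢 j) (h𝒢le : ∀ i, 𝒢 i ≤ m0)
    {X : Type*} [MeasurableSpace X]
    (R : ℝ) (hR : 0 < R)
    (Hcl : Finset (X → ℝ)) (hHne : Hcl.Nonempty)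
    (hHmeas : ∀ h ∈ Hcl, Measurable h)
    (hHbdd : ∀ h ∈ Hcl, ∀ z, |h z| ≤ R)
    (hstar : X → ℝ) (hstarMeas : Measurable hstar) (hstarBdd : ∀ z, |hstar z| ≤ R)
    (ℋ : ℕ → MeasurableSpace Ω)
    (hℋ : ∀ t ∈ Finset.Icc 1 T, 𝒢 (t - 1) ≤ ℋ t ∧ ℋ t ≤ 𝒢 t)
    (x : ℕ → Ω → X) (hx : ∀ t ∈ Finset.Icc 1 T, Measurable[ℋ t] (x t))
    (y : ℕ → Ω → ℝ) (hy : ∀ t ∈ Finset.Icc 1 T, Measurable[𝒢 t] (y t))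
    (hybdd : ∀ t ∈ Finset.Icc 1 T, ∀ᵐ ω ∂μ, |y t ω| ≤ R)
    (hcond : ∀ t ∈ Finset.Icc 1 T, μ[y t | ℋ t] =ᵐ[μ] fun ω => hstar (x t ω))
    (γ : ℝ) (hγ : 0 ≤ γ)
    (hrealiz : ∀ᵐ ω ∂μ, ∃ h ∈ Hcl,
      ∑ t ∈ Finset.Icc 1 T,
          (μ[fun ω' => (hstar (x t ω') - h (x t ω')) ^ 2 | 𝒢 (t - 1)]) ω ≤ γ * T)
    (erm : Ω → (X → ℝ))
    (hermMem : ∀ᵐ ω ∂μ, erm ω ∈ Hcl)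
    (hermMeas : ∀ h ∈ Hcl, MeasurableSet[𝒢 T] {ω | erm ω = h})
    (hermMin : ∀ᵐ ω ∂μ, ∀ h ∈ Hcl,
      ∑ t ∈ Finset.Icc 1 T, (erm ω (x t ω) - y t ω) ^ 2
        ≤ ∑ t ∈ Finset.Icc 1 T, (h (x t ω) - y t ω) ^ 2)
    (δ : ℝ) (hδ : 0 < δ) (hδ1 : δ < 1) :
    ENNReal.ofReal (1 - δ) ≤
      μ {ω | ∑ t ∈ Finset.Icc 1 T,
          (μ[fun ω' => (erm ω (x t ω') - hstar (x t ω')) ^ 2 | 𝒢 (t - 1)]) ω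
            ≤ 3 * γ * T + 256 * R ^ 2 * Real.log (2 * Hcl.card / δ)} := by
  set L := Real.log (2 * Hcl.card / δ) with hL
  have hcard : (0 : ℝ) < Hcl.card := by exact_mod_cast hHne.card_pos
  have hcard1 : (1 : ℝ) ≤ Hcl.card := by exact_mod_cast hHne.card_pos
  have hL0 : 0 ≤ L := Real.log_nonneg (by rw [le_div_iff₀ hδ]; linarith)
  have hexp : Real.exp (-L) = δ / (2 * Hcl.card) := by
    rw [Real.exp_neg, hL, Real.exp_log (by positivity), inv_div]
  set E : ℝ → (X → ℝ) → Set Ω := fun s h => {ω | 32 * R ^ 2 * L ≤ ∑ t ∈ Finset.Icc 1 T,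
        (s * ((h (x t ω) - y t ω) ^ 2 - (hstar (x t ω) - y t ω) ^ 2) -
          (s + 1 / 2) * (μ[fun ω' => (h (x t ω') - hstar (x t ω')) ^ 2 | 𝒢 (t - 1)]) ω)} with hE
  have tail : ∀ s : ℝ, |s| = 1 → ∀ h ∈ Hcl, μ (E s h) ≤ ENNReal.ofReal (δ / (2 * Hcl.card)) := by
    intro s hs h hh
    rw [← hexp]
    exact aux_tail μ T 𝒢 h𝒢mono h𝒢le R hR h (hHmeas h hh) (hHbdd h hh) hstar hstarMeas hstarBdd
      ℋ hℋ x hx y hy hybdd hcond s hs L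
  set good : Set Ω := {ω | ∑ t ∈ Finset.Icc 1 T,
          (μ[fun ω' => (erm ω (x t ω') - hstar (x t ω')) ^ 2 | 𝒢 (t - 1)]) ω
            ≤ 3 * γ * T + 256 * R ^ 2 * L} with hgood
  have hbad : μ goodᶜ ≤ ENNReal.ofReal δ := by
    have hsub : μ goodᶜ ≤ μ (⋃ h ∈ Hcl, (E 1 h ∪ E (-1) h)) := by
      refine measure_mono_ae ?_
      filter_upwards [hrealiz, hermMem, hermMin] with ω h1 h2 h3 hω
      by_contra hcon
      apply hω
      have hcon' : ∀ h ∈ Hcl, ω ∉ E 1 h ∧ ω ∉ E (-1) h := by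
        intro h hh
        constructor <;> intro hm <;> apply hcon
        · exact Set.mem_biUnion hh (Or.inl hm)
        · exact Set.mem_biUnion hh (Or.inr hm)
      obtain ⟨h, hh, hsum⟩ := h1
      have a1 := (hcon' h hh).1
      have a2 := (hcon' _ h2).2
      have a3 := h3 h hh
      have esw : ∀ t, (fun ω' => (hstar (x t ω') - h (x t ω')) ^ 2) =
          fun ω' => (h (x t ω') - hstar (x t ω')) ^ 2 := fun t => by funext ω'; ring
      simp only [esw] at hsum
      simp only [hE, Set.mem_setOf_eq, not_le, Finset.sum_sub_distrib, ← Finset.mul_sum] at a1 a2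
      change ∑ t ∈ Finset.Icc 1 T,
          (μ[fun ω' => (erm ω (x t ω') - hstar (x t ω')) ^ 2 | 𝒢 (t - 1)]) ω
            ≤ 3 * γ * T + 256 * R ^ 2 * L
      have : 0 ≤ R ^ 2 * L := by positivity
      linarith
    refine hsub.trans ((measure_biUnion_finset_le _ _).trans ?_)
    calc ∑ h ∈ Hcl, μ (E 1 h ∪ E (-1) h)
        ≤ ∑ h ∈ Hcl, ENNReal.ofReal (δ / Hcl.card) := by
          refine Finset.sum_le_sum fun h hh => (measure_union_le _ _).trans ?_
          refine (add_le_add (tail 1 (by simp) h hh) (tail (-1) (by simp) h hh)).trans ?_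
          rw [← ENNReal.ofReal_add (by positivity) (by positivity)]
          refine le_of_eq ?_
          congr 1
          field_simp
          norm_num
      _ = ENNReal.ofReal δ := by
          rw [← ENNReal.ofReal_sum_of_nonneg (fun _ _ => by positivity)]
          congr 1
          rw [Finset.sum_const, nsmul_eq_mul]
          field_simp
  have h1 : (1 : ENNReal) ≤ μ good + ENNReal.ofReal δ := by
    rw [← measure_univ (μ := μ)]
    exact (measure_univ_le_add_compl good).trans (by gcongr)
  rw [ENNReal.ofReal_sub _ hδ.le, ENNReal.ofReal_one]
  exact tsub_le_iff_right.2 h1
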